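/- arXiv:1811.09609 — 13 statements merged into one kernel-verified Lean document; each statement's English description precedes it below -/
import Mathlib

section
/- Let E be an equivalence relation and T a tolerance on a set U. Then T is E-compatible if and only if T is a similarity relation extending E, that is: (Ex1) for all x ∈ U, [x]_E ⊆ T(x), and (Ex2) for all x, y ∈ U, y ∈ T(x) implies [y]_E ⊆ T(x). -/
/-- The relational product `R ∘ S = {(x,y) | ∃ z, x R z and z S y}`. -/
def relComp {U : Type*} (R S : U → U → Prop) : U → U → Prop :=
  fun x y => ∃ z, R x z ∧ S z y

/-- The lower approximation `X_R = {x | R(x) ⊆ X}`. -/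
def lowerAppr {U : Type*} (R : U → U → Prop) (X : Set U) : Set U :=
  {x | ∀ y, R x y → y ∈ X}

/-- The upper approximation `X^R = {x | R(x) ∩ X ≠ ∅}`. -/
def upperAppr {U : Type*} (R : U → U → Prop) (X : Set U) : Set U :=
  {x | ∃ y, R x y ∧ y ∈ X}

/-- The neighbourhood `R(x) = {y | x R y}`. -/
def nbhd {U : Type*} (R : U → U → Prop) (x : U) : Set U :=
  {y | R x y}

/-- A tolerance `T` is `E`-compatible if `E ∘ T ⊆ T`. -/
def Compatible {U : Type*} (E T : U → U → Prop) : Prop :=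
  ∀ x y, relComp E T x y → T x y

/-- `T` is `E`-compatible iff `T` is a similarity relation extending `E`,
i.e. (Ex1) `[x]_E ⊆ T(x)` for all `x`, and (Ex2) `y ∈ T(x)` implies `[y]_E ⊆ T(x)`. -/
theorem compatible_iff_similarity_extending {U : Type*} (E T : U → U → Prop)
    (hE : Equivalence E) (hTrefl : Reflexive T) (hTsymm : Symmetric T) :
    Compatible E T ↔
      ((∀ x : U, {y | E x y} ⊆ nbhd T x) ∧
       (∀ x y : U, y ∈ nbhd T x → {z | E y z} ⊆ nbhd T x)) := by
  constructor
  · intro h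
    exact ⟨fun x y hxy => h x y ⟨y, hxy, hTrefl y⟩,
      fun x y hxy z hyz => hTsymm (h z x ⟨y, hE.symm hyz, hTsymm hxy⟩)⟩
  · rintro ⟨-, h⟩ x y ⟨z, hxz, hzy⟩
    exact hTsymm (h y z (hTsymm hzy) (hE.symm hxz))
end

section
/- Let E be an equivalence on a set U and let T be an E-compatible tolerance on U. Then for every subset X of U: (a) (X^T)^E = X^T = (X^E)^T, and (b) (X_T)_E = X_T = (X_E)_T. -/
theorem Compatible.right {U : Type*} {E T : U → U → Prop} (hcomp : Compatible E T)
    (hE : Equivalence E) (hTsymm : Symmetric T) {x y z : U} (hxy : T x y) (hyz : E y z) :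
    T x z :=
  hTsymm (hcomp z x ⟨y, hE.symm hyz, hTsymm hxy⟩)

/-- if `T` is an `E`-compatible tolerance, then for every `X ⊆ U`,
`(X^T)^E = X^T = (X^E)^T` and `(X_T)_E = X_T = (X_E)_T`. -/
theorem appr_compatible_eq {U : Type*} (E T : U → U → Prop)
    (hE : Equivalence E) (hTrefl : Reflexive T) (hTsymm : Symmetric T)
    (hcomp : Compatible E T) (X : Set U) :
    (upperAppr E (upperAppr T X) = upperAppr T X ∧
     upperAppr T (upperAppr E X) = upperAppr T X) ∧
    (lowerAppr E (lowerAppr T X) = lowerAppr T X ∧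
     lowerAppr T (lowerAppr E X) = lowerAppr T X) := by
  refine ⟨⟨?_, ?_⟩, ?_, ?_⟩ <;> ext x <;> constructor
  · rintro ⟨y, hxy, z, hyz, hz⟩
    exact ⟨z, hcomp x z ⟨y, hxy, hyz⟩, hz⟩
  · exact fun hx => ⟨x, hE.refl x, hx⟩
  · rintro ⟨y, hxy, z, hyz, hz⟩
    exact ⟨z, hcomp.right hE hTsymm hxy hyz, hz⟩
  · rintro ⟨y, hxy, hy⟩
    exact ⟨y, hxy, y, hE.refl y, hy⟩
  · exact fun hx => hx x (hE.refl x)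
  · exact fun hx y hxy z hyz => hx z (hcomp x z ⟨y, hxy, hyz⟩)
  · exact fun hx y hxy => hx y hxy y (hE.refl y)
  · exact fun hx y hxy z hyz => hx z (hcomp.right hE hTsymm hxy hyz)
end

section
/- Let E be an equivalence on a set U and let T be an E-compatible tolerance on U. Then for every subset X of U: (a) X^T = ⋃ { [x]_E | x ∈ U and T(x) ∩ X ≠ ∅ }, and (b) X_T = ⋃ { [x]_E | x ∈ U and T(x) ⊆ X }. -/
/-- if `T` is an `E`-compatible tolerance, then
`X^T = ⋃ {[x]_E | T(x) ∩ X ≠ ∅}` and `X_T = ⋃ {[x]_E | T(x) ⊆ X}`. -/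
theorem appr_eq_union_classes {U : Type*} (E T : U → U → Prop)
    (hE : Equivalence E) (hTrefl : Reflexive T) (hTsymm : Symmetric T)
    (hcomp : Compatible E T) (X : Set U) :
    upperAppr T X = ⋃ x ∈ {x : U | (nbhd T x ∩ X).Nonempty}, {y | E x y} ∧
    lowerAppr T X = ⋃ x ∈ {x : U | nbhd T x ⊆ X}, {y | E x y} := by
  constructor
  · ext z
    simp only [Set.mem_iUnion, Set.mem_ofPred_eq, exists_prop]
    constructor
    · rintro ⟨y, hzy, hy⟩
      exact ⟨z, ⟨y, hzy, hy⟩, hE.refl z⟩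
    · rintro ⟨x, ⟨y, hxy, hy⟩, hxz⟩
      exact ⟨y, hcomp z y ⟨x, hE.symm hxz, hxy⟩, hy⟩
  · ext z
    simp only [Set.mem_iUnion, Set.mem_ofPred_eq, exists_prop]
    constructor
    · intro hz
      exact ⟨z, fun y hy => hz y hy, hE.refl z⟩
    · rintro ⟨x, hx, hxz⟩ y hzy
      exact hx (hcomp x y ⟨z, hxz, hzy⟩)
end

section
/- Let U be a set of objects, A a set of attributes where each attribute a ∈ A is a function a : U → V_a, and let B be a nonempty subset of A. Define the strong indistinguishability relation ind(B) = {(x,y) ∈ U² | ∀a ∈ B, a(x) = a(y)} and the weak indistinguishability relation wind(B) = {(x,y) ∈ U² | ∃a ∈ B, a(x) = a(y)}. Then wind(B) is an ind(B)-compatible tolerance, i.e., wind(B) is reflexive and symmetric and ind(B) ∘ wind(B) ⊆ wind(B). -/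
/-- in an information system, for a nonempty attribute set `B`,
the weak indistinguishability relation `wind(B)` is an `ind(B)`-compatible tolerance. -/
theorem wind_compatible_ind {U : Type*} {ι : Type*} {V : ι → Type*}
    (f : (i : ι) → U → V i) (B : Set ι) (hB : B.Nonempty) :
    Reflexive (fun x y : U => ∃ i ∈ B, f i x = f i y) ∧
    Symmetric (fun x y : U => ∃ i ∈ B, f i x = f i y) ∧
    Compatible (fun x y : U => ∀ i ∈ B, f i x = f i y)
      (fun x y : U => ∃ i ∈ B, f i x = f i y) := by
  refine ⟨fun x => ?_, ?_, ?_⟩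
  · obtain ⟨i, hi⟩ := hB
    exact ⟨i, hi, rfl⟩
  · rintro x y ⟨i, hi, h⟩
    exact ⟨i, hi, h.symm⟩
  · rintro x y ⟨z, hxz, i, hi, hzy⟩
    exact ⟨i, hi, (hxz i hi).trans hzy⟩
end

section
/- Let E be an equivalence and T a tolerance on a set U. Then T is E-compatible if and only if every T-block is E-definable, where a T-block is a subset B of U maximal (with respect to inclusion) among nonempty sets satisfying B × B ⊆ T, and a set X ⊆ U is E-definable if x ∈ X and x E y imply y ∈ X. -/
/-- A `T`-preblock: a nonempty set `B` with `B × B ⊆ T`. -/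
def IsPreblock {U : Type*} (T : U → U → Prop) (B : Set U) : Prop :=
  B.Nonempty ∧ ∀ x ∈ B, ∀ y ∈ B, T x y

/-- A `T`-block: a `T`-preblock maximal with respect to inclusion. -/
def IsBlock {U : Type*} (T : U → U → Prop) (B : Set U) : Prop :=
  IsPreblock T B ∧ ∀ C : Set U, IsPreblock T C → B ⊆ C → B = C

/-- Inserting a point related to every element of a preblock gives a preblock. -/
theorem IsPreblock.insert {U : Type*} {T : U → U → Prop} (hTrefl : Reflexive T)
    (hTsymm : Symmetric T) {B : Set U} (hB : IsPreblock T B) {y : U}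
    (hy : ∀ z ∈ B, T y z) : IsPreblock T (insert y B) := by
  refine ⟨Set.insert_nonempty y B, ?_⟩
  rintro a (rfl | ha) b (rfl | hb)
  · exact hTrefl _
  · exact hy b hb
  · exact hTsymm (hy a ha)
  · exact hB.2 a ha b hb

/-- Every preblock is contained in a block. -/
theorem IsPreblock.exists_isBlock_superset {U : Type*} {T : U → U → Prop} {A : Set U}
    (hA : IsPreblock T A) : ∃ B, A ⊆ B ∧ IsBlock T B := by
  obtain ⟨B, hAB, hB⟩ := zorn_subset_nonempty {B | IsPreblock T B} (fun c hc hchain hne => by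
    obtain ⟨s, hs⟩ := hne
    refine ⟨⋃₀ c, ⟨(hc hs).1.mono (Set.subset_sUnion_of_mem hs), ?_⟩,
      fun t ht => Set.subset_sUnion_of_mem ht⟩
    rintro x ⟨t, ht, hxt⟩ y ⟨u, hu, hyu⟩
    rcases hchain.total ht hu with h | h
    · exact (hc hu).2 x (h hxt) y hyu
    · exact (hc ht).2 x hxt y (h hyu)) A hA
  exact ⟨B, hAB, hB.prop, fun C hC hBC => hB.eq_of_subset hC hBC⟩

/-- `T` is `E`-compatible iff every `T`-block is `E`-definable. -/
theorem compatible_iff_blocks_definable {U : Type*} (E T : U → U → Prop)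
    (hE : Equivalence E) (hTrefl : Reflexive T) (hTsymm : Symmetric T) :
    Compatible E T ↔
      ∀ B : Set U, IsBlock T B → ∀ x ∈ B, ∀ y, E x y → y ∈ B := by
  constructor
  · intro hcomp B hB x hx y hxy
    have hC : IsPreblock T (insert y B) := hB.1.insert hTrefl hTsymm fun z hz =>
      hcomp y z ⟨x, hE.symm hxy, hB.1.2 x hx z hz⟩
    rw [hB.2 _ hC (Set.subset_insert y B)]
    exact Set.mem_insert y B
  · rintro hdef x y ⟨z, hxz, hzy⟩
    have hy : IsPreblock T {y} :=
      ⟨Set.singleton_nonempty y, by rintro _ rfl _ rfl; exact hTrefl _⟩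
    have hpair : IsPreblock T {z, y} :=
      hy.insert hTrefl hTsymm (by rintro _ rfl; exact hzy)
    obtain ⟨B, hsub, hB⟩ := hpair.exists_isBlock_superset
    exact hB.1.2 x (hdef B hB z (hsub (by simp)) x (hE.symm hxz)) y (hsub (by simp))
end

section
/- Let C be an irredundant covering of a set U and let T = T_C be the tolerance induced by C. Then ker T = {(x,y) ∈ U² | for all B ∈ C, x ∈ B if and only if y ∈ B}. -/
/-- A member of an irredundant covering has a point lying in no other member. -/
theorem exists_mem_iff_eq_of_irredundant {U : Type*} {C : Set (Set U)}
    (hcov : ⋃₀ C = Set.univ) {B : Set U} (hB : ⋃₀ (C \ {B}) ≠ Set.univ) :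
    ∃ z, ∀ A ∈ C, z ∈ A ↔ A = B := by
  obtain ⟨z, hz⟩ := (Set.ne_univ_iff_exists_notMem _).1 hB
  have eq_of_mem : ∀ A ∈ C, z ∈ A → A = B := fun A hA hzA =>
    by_contra fun h => hz ⟨A, ⟨hA, h⟩, hzA⟩
  obtain ⟨A, hA, hzA⟩ : z ∈ ⋃₀ C := hcov ▸ Set.mem_univ z
  refine ⟨z, fun A' hA' => ⟨eq_of_mem A' hA', ?_⟩⟩
  rintro rfl
  exact eq_of_mem A hA hzA ▸ hzA

/-- for the tolerance `T` induced by an irredundant covering `C` of `U`,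
`ker T = {(x,y) | ∀ B ∈ C, x ∈ B ↔ y ∈ B}`. -/
theorem ker_of_irredundant_covering {U : Type*} (C : Set (Set U))
    (hne : ∀ B ∈ C, B.Nonempty) (hcov : ⋃₀ C = Set.univ)
    (hirr : ∀ B ∈ C, ⋃₀ (C \ {B}) ≠ Set.univ)
    (T : U → U → Prop) (hT : T = fun x y : U => ∃ B ∈ C, x ∈ B ∧ y ∈ B) :
    ∀ x y : U, nbhd T x = nbhd T y ↔ ∀ B ∈ C, (x ∈ B ↔ y ∈ B) := by
  subst hT
  intro x y
  constructor
  · intro h B hB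
    obtain ⟨z, hz⟩ := exists_mem_iff_eq_of_irredundant hcov (hirr B hB)
    have mem_iff : ∀ w, w ∈ B ↔ z ∈ nbhd (fun x y : U => ∃ B ∈ C, x ∈ B ∧ y ∈ B) w := by
      refine fun w => ⟨fun hw => ⟨B, hB, hw, (hz B hB).2 rfl⟩, ?_⟩
      rintro ⟨A, hA, hwA, hzA⟩
      exact (hz A hA).1 hzA ▸ hwA
    rw [mem_iff x, mem_iff y, h]
  · intro h
    ext z
    exact exists_congr fun B => and_congr_right fun hB => and_congr_left' (h B hB)
end

section
/- Let E be an equivalence on a set U and let T be an E-compatible tolerance. Then for every family H of subsets of U, there exists a subset Y of U such that Y_E = ⋃_{X∈H} X_E and Y^T = ⋃_{X∈H} X^T; moreover, the pair (⋃_{X∈H} X_E, ⋃_{X∈H} X^T) is the least upper bound of the set {(X_E, X^T) | X ∈ H} in RS(E,T) = {(X_E, X^T) | X ⊆ U} ordered by coordinatewise inclusion. -/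
/-- Members of `lowerAppr E X` are stable under an equivalence `E`. -/
theorem mem_lowerAppr_of_rel {U : Type*} {E : U → U → Prop} (hE : Equivalence E)
    {X : Set U} {x y : U} (hxy : E x y) (hx : x ∈ lowerAppr E X) : y ∈ lowerAppr E X :=
  fun _ hyz => hx _ (hE.trans hxy hyz)

/-- Neighbourhoods of a compatible tolerance are unions of `E`-classes. -/
theorem Compatible.rel_right {U : Type*} {E T : U → U → Prop} (hcomp : Compatible E T)
    (hE : Equivalence E) (hT : Symmetric T) {x y z : U} (hxy : T x y) (hyz : E y z) : T x z :=
  hT (hcomp z x ⟨y, hE.symm hyz, hT hxy⟩)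

/-- The union of the lower approximations and the union of the upper approximations of a family
are the approximations of a single set: add to the former union one representative of each
other `E`-class that meets the family. -/
theorem exists_lowerAppr_upperAppr_eq_iUnion {U : Type*} {E T : U → U → Prop}
    (hE : Equivalence E) (hT : Symmetric T) (hcomp : Compatible E T) (H : Set (Set U)) :
    ∃ Y : Set U, lowerAppr E Y = ⋃ X ∈ H, lowerAppr E X ∧
      upperAppr T Y = ⋃ X ∈ H, upperAppr T X := by
  obtain ⟨rep, hrep, hrep_eq⟩ :
      ∃ rep : U → U, (∀ x, E x (rep x)) ∧ ∀ x y, E x y → rep x = rep y := by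
    let s : Setoid U := ⟨E, hE⟩
    refine ⟨fun x => (Quotient.mk s x).out, fun x => hE.symm (Quotient.mk_out (s := s) x),
      fun x y h => ?_⟩
    exact congrArg Quotient.out (Quotient.sound (s := s) h)
  refine ⟨{y | (∃ X ∈ H, y ∈ lowerAppr E X) ∨ (y = rep y ∧ ∃ X ∈ H, ∃ z ∈ X, E y z)}, ?_, ?_⟩
  · ext x
    simp only [Set.mem_iUnion, exists_prop]
    constructor
    · intro hx
      by_contra hL
      have key : ∀ y, E x y → y = rep y ∧ ∃ X ∈ H, ∃ z ∈ X, E y z := by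
        intro y hxy
        refine (hx y hxy).resolve_left ?_
        rintro ⟨X, hX, hy⟩
        exact hL ⟨X, hX, mem_lowerAppr_of_rel hE (hE.symm hxy) hy⟩
      have hsing : ∀ y, E x y → y = x := fun y hxy =>
        (key y hxy).1.trans ((hrep_eq x y hxy).symm.trans (key x (hE.refl x)).1.symm)
      obtain ⟨-, X, hX, z, hz, hxz⟩ := key x (hE.refl x)
      refine hL ⟨X, hX, fun y hxy => ?_⟩
      rw [hsing y hxy, ← hsing z hxz]
      exact hz
    · rintro ⟨X, hX, hx⟩ y hxy
      exact Or.inl ⟨X, hX, mem_lowerAppr_of_rel hE hxy hx⟩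
  · ext x
    simp only [Set.mem_iUnion, exists_prop]
    constructor
    · rintro ⟨y, hxy, ⟨X, hX, hy⟩ | ⟨-, X, hX, z, hz, hyz⟩⟩
      · exact ⟨X, hX, y, hxy, hy y (hE.refl y)⟩
      · exact ⟨X, hX, z, hcomp.rel_right hE hT hxy hyz, hz⟩
    · rintro ⟨X, hX, z, hxz, hz⟩
      exact ⟨rep z, hcomp.rel_right hE hT hxz (hrep z),
        Or.inr ⟨hrep_eq z _ (hrep z), X, hX, z, hz, hE.symm (hrep z)⟩⟩

/-- for an `E`-compatible tolerance `T` and a family `H ⊆ ℘(U)`,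
the pair `(⋃_{X∈H} X_E, ⋃_{X∈H} X^T)` belongs to `RS(E,T)` and is the least upper
bound of `{(X_E, X^T) | X ∈ H}` in `RS(E,T)` (coordinatewise inclusion). -/
theorem RS_join {U : Type*} (E T : U → U → Prop)
    (hE : Equivalence E) (hTrefl : Reflexive T) (hTsymm : Symmetric T)
    (hcomp : Compatible E T) (H : Set (Set U)) :
    (∃ Y : Set U, lowerAppr E Y = ⋃ X ∈ H, lowerAppr E X ∧
       upperAppr T Y = ⋃ X ∈ H, upperAppr T X) ∧
    (∀ X ∈ H, lowerAppr E X ⊆ ⋃ X ∈ H, lowerAppr E X ∧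
       upperAppr T X ⊆ ⋃ X ∈ H, upperAppr T X) ∧
    (∀ Z : Set U,
      (∀ X ∈ H, lowerAppr E X ⊆ lowerAppr E Z ∧ upperAppr T X ⊆ upperAppr T Z) →
      (⋃ X ∈ H, lowerAppr E X) ⊆ lowerAppr E Z ∧
      (⋃ X ∈ H, upperAppr T X) ⊆ upperAppr T Z) := by
  exact ⟨exists_lowerAppr_upperAppr_eq_iUnion hE hTsymm hcomp H,
    fun X hX => ⟨Set.subset_biUnion_of_mem (u := lowerAppr E) hX,
      Set.subset_biUnion_of_mem (u := upperAppr T) hX⟩,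
    fun Z hZ => ⟨Set.iUnion₂_subset fun X hX => (hZ X hX).1,
      Set.iUnion₂_subset fun X hX => (hZ X hX).2⟩⟩
end

section
/- Let E be an equivalence on a set U and let T be an E-compatible tolerance. For a family H of subsets of U, let Σ_E(H) = ((⋂_{X∈H} (X^T)_T) \ (⋂_{X∈H} X_E)) ∩ Σ_E, where Σ_E = {x ∈ U | [x]_E = {x}}. Then there exists a subset Y of U with Y_E = ⋂_{X∈H} X_E and Y^T = ((⋂_{X∈H} (X^T)_T) \ Σ_E(H))^T; moreover, the pair (⋂_{X∈H} X_E, ((⋂_{X∈H} (X^T)_T) \ Σ_E(H))^T) is the greatest lower bound of {(X_E, X^T) | X ∈ H} in RS(E,T) = {(X_E, X^T) | X ⊆ U} ordered by coordinatewise inclusion. -/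
/-- `Σ_E`: the set of elements whose `E`-class is a singleton. -/
def SigmaRel {U : Type*} (E : U → U → Prop) : Set U :=
  {x | {y | E x y} = {x}}

/-- `Σ_E(H) = ((⋂_{X∈H} (X^T)_T) \ (⋂_{X∈H} X_E)) ∩ Σ_E`. -/
def SigmaEH {U : Type*} (E T : U → U → Prop) (H : Set (Set U)) : Set U :=
  ((⋂ X ∈ H, lowerAppr T (upperAppr T X)) \ ⋂ X ∈ H, lowerAppr E X) ∩ SigmaRel E

/-- Every equivalence relation has a function choosing a representative of each class. -/
theorem Equivalence.exists_representative {U : Type*} {E : U → U → Prop} (hE : Equivalence E) :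
    ∃ f : U → U, (∀ x, E x (f x)) ∧ ∀ x y, E x y → f x = f y := by
  let s : Setoid U := ⟨E, hE⟩
  exact ⟨fun x => (Quotient.mk s x).out, fun x => hE.symm (Quotient.mk_out (s := s) x),
    fun x y h => congrArg Quotient.out (Quotient.sound (s := s) h)⟩

theorem mem_SigmaRel {U : Type*} {E : U → U → Prop} (hE : Equivalence E) {x : U} :
    x ∈ SigmaRel E ↔ ∀ y, E x y → y = x := by
  constructor
  · intro h y hy
    exact (Set.ext_iff.1 h y).1 hy
  · intro h
    ext y
    exact ⟨h y, fun hy => hy ▸ hE.refl y⟩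

/-- If `A` and `C` are `E`-saturated, `A ⊆ C` and all singleton classes in `C` lie in `A`, then
some `Y` has lower approximation `A` and the same upper approximation as `C`. -/
theorem exists_lowerAppr_eq_and_upperAppr_eq {U : Type*} {E T : U → U → Prop}
    (hE : Equivalence E) (hTE : ∀ x y z, T x y → E y z → T x z) {A C : Set U}
    (hA : ∀ x y, E x y → x ∈ A → y ∈ A) (hC : ∀ x y, E x y → x ∈ C → y ∈ C)
    (hAC : A ⊆ C) (hS : ∀ x ∈ C, x ∈ SigmaRel E → x ∈ A) :
    ∃ Y : Set U, lowerAppr E Y = A ∧ upperAppr T Y = upperAppr T C := by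
  obtain ⟨f, hf, hf'⟩ := hE.exists_representative
  refine ⟨A ∪ {x | x ∈ C ∧ f x = x}, ?_, ?_⟩
  · ext x
    refine ⟨fun hx => ?_, fun hx y hxy => Or.inl (hA x y hxy hx)⟩
    by_contra hxA
    have key : ∀ y, E x y → y ∈ C ∧ f y = y := fun y hxy =>
      (hx y hxy).resolve_left fun hy => hxA (hA y x (hE.symm hxy) hy)
    have hxx := key x (hE.refl x)
    exact hxA (hS x hxx.1 ((mem_SigmaRel hE).2 fun y hxy => by
      rw [← (key y hxy).2, ← hf' x y hxy, hxx.2]))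
  · ext x
    constructor
    · rintro ⟨y, hxy, hy | hy⟩
      exacts [⟨y, hxy, hAC hy⟩, ⟨y, hxy, hy.1⟩]
    · rintro ⟨y, hxy, hy⟩
      exact ⟨f y, hTE x y _ hxy (hf y), Or.inr ⟨hC y _ (hf y) hy, (hf' y _ (hf y)).symm⟩⟩

/-- for an `E`-compatible tolerance `T` and a family `H ⊆ ℘(U)`, the pair
`(⋂_{X∈H} X_E, ((⋂_{X∈H} (X^T)_T) \ Σ_E(H))^T)` belongs to `RS(E,T)` and is the greatest
lower bound of `{(X_E, X^T) | X ∈ H}` in `RS(E,T)` (coordinatewise inclusion). -/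
theorem RS_meet {U : Type*} (E T : U → U → Prop)
    (hE : Equivalence E) (hTrefl : Reflexive T) (hTsymm : Symmetric T)
    (hcomp : Compatible E T) (H : Set (Set U)) :
    (∃ Y : Set U, lowerAppr E Y = ⋂ X ∈ H, lowerAppr E X ∧
       upperAppr T Y =
         upperAppr T ((⋂ X ∈ H, lowerAppr T (upperAppr T X)) \ SigmaEH E T H)) ∧
    (∀ X ∈ H, (⋂ X ∈ H, lowerAppr E X) ⊆ lowerAppr E X ∧
       upperAppr T ((⋂ X ∈ H, lowerAppr T (upperAppr T X)) \ SigmaEH E T H) ⊆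
         upperAppr T X) ∧
    (∀ Z : Set U,
      (∀ X ∈ H, lowerAppr E Z ⊆ lowerAppr E X ∧ upperAppr T Z ⊆ upperAppr T X) →
      lowerAppr E Z ⊆ (⋂ X ∈ H, lowerAppr E X) ∧
      upperAppr T Z ⊆
        upperAppr T ((⋂ X ∈ H, lowerAppr T (upperAppr T X)) \ SigmaEH E T H)) := by
  have hTE : ∀ x y z, T x y → E y z → T x z := fun x y z hxy hyz =>
    hTsymm (hcomp z x ⟨y, hE.symm hyz, hTsymm hxy⟩)
  have hA : ∀ x y, E x y → x ∈ (⋂ X ∈ H, lowerAppr E X) → y ∈ ⋂ X ∈ H, lowerAppr E X := by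
    intro x y hxy hx
    simp only [Set.mem_iInter] at hx ⊢
    exact fun X hX z hyz => hx X hX z (hE.trans hxy hyz)
  have hB : ∀ x y, E x y → x ∈ (⋂ X ∈ H, lowerAppr T (upperAppr T X)) →
      y ∈ ⋂ X ∈ H, lowerAppr T (upperAppr T X) := by
    intro x y hxy hx
    simp only [Set.mem_iInter] at hx ⊢
    exact fun X hX z hyz => hx X hX z (hcomp x z ⟨y, hxy, hyz⟩)
  have hAB : (⋂ X ∈ H, lowerAppr E X) ⊆ ⋂ X ∈ H, lowerAppr T (upperAppr T X) := by
    intro x hx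
    simp only [Set.mem_iInter] at hx ⊢
    exact fun X hX y hxy => ⟨x, hTsymm hxy, hx X hX x (hE.refl x)⟩
  refine ⟨exists_lowerAppr_eq_and_upperAppr_eq hE hTE hA ?_ ?_ ?_, ?_, ?_⟩
  · rintro x y hxy ⟨hxB, hxS⟩
    refine ⟨hB x y hxy hxB, fun hyS => hxS ?_⟩
    rwa [(mem_SigmaRel hE).1 hyS.2 x (hE.symm hxy)]
  · exact fun x hx => ⟨hAB hx, fun hxS => hxS.1.2 hx⟩
  · rintro x ⟨hxB, hxS⟩ hx
    by_contra hxA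
    exact hxS ⟨⟨hxB, hxA⟩, hx⟩
  · refine fun X hX => ⟨Set.biInter_subset_of_mem hX, ?_⟩
    rintro x ⟨y, hxy, hyB, -⟩
    exact Set.mem_iInter₂.1 hyB X hX x (hTsymm hxy)
  · intro Z hZ
    have hZA : lowerAppr E Z ⊆ ⋂ X ∈ H, lowerAppr E X :=
      Set.subset_iInter₂ fun X hX => (hZ X hX).1
    refine ⟨hZA, ?_⟩
    rintro x ⟨z, hxz, hz⟩
    refine ⟨z, hxz, ?_, fun hzS => hzS.1.2 (hZA fun y hzy => ?_)⟩
    · exact Set.mem_iInter₂.2 fun X hX y hzy => (hZ X hX).2 ⟨z, hTsymm hzy, hz⟩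
    · rwa [(mem_SigmaRel hE).1 hzS.2 y hzy]
end

section
/- Let T be the tolerance induced by an irredundant covering of a set U and let E be an equivalence on U such that T is E-compatible. Then the following are equivalent: (a) for every family H of subsets of U there exists Y ⊆ U with Y_E = ⋂_{X∈H} X_E and Y^T = ((⋂_{X∈H} X^T)_T)^T; (b) condition (CSub) holds: for each x ∈ Σ_E \ Σ_T such that T(x) is a T-block, there exists an element y ∉ Σ_E with T(y) = T(x). -/
/-- `Σ_E`: the set of elements whose `E`-class is a singleton. -/
def SigmaE {U : Type*} (E : U → U → Prop) : Set U :=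
  {x | {y | E x y} = {x}}

/-- `Σ_T`: the set of elements whose `T`-neighbourhood is a singleton. -/
def SigmaT {U : Type*} (T : U → U → Prop) : Set U :=
  {x | nbhd T x = {x}}

/-- Every member of an irredundant covering is the neighbourhood of one of its points. -/
theorem exists_nbhd_eq_of_irredundant {U : Type*} {C : Set (Set U)} (hcov : ⋃₀ C = Set.univ)
    (hirr : ∀ B ∈ C, ⋃₀ (C \ {B}) ≠ Set.univ) {B : Set U} (hB : B ∈ C) :
    ∃ b, nbhd (fun x y : U => ∃ B ∈ C, x ∈ B ∧ y ∈ B) b = B := by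
  obtain ⟨b, hb⟩ := (Set.ne_univ_iff_exists_notMem _).1 (hirr B hB)
  have huniq : ∀ D ∈ C, b ∈ D → D = B := fun D hD hbD => by
    by_contra h
    exact hb ⟨D, ⟨hD, h⟩, hbD⟩
  have hbB : b ∈ B := by
    obtain ⟨D, hD, hbD⟩ : b ∈ ⋃₀ C := hcov ▸ Set.mem_univ b
    exact huniq D hD hbD ▸ hbD
  refine ⟨b, Set.ext fun y => ⟨?_, fun hy => ⟨B, hB, hbB, hy⟩⟩⟩
  rintro ⟨D, hD, hbD, hy⟩
  exact huniq D hD hbD ▸ hy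

/-- A neighbourhood that is a preblock is a block. -/
theorem IsPreblock.isBlock_nbhd {U : Type*} {T : U → U → Prop} {x : U} (hx : T x x)
    (h : IsPreblock T (nbhd T x)) : IsBlock T (nbhd T x) :=
  ⟨h, fun _ hD hsub => hsub.antisymm fun y hy => hD.2 x (hsub hx) y hy⟩

/-- If `T(x)` is a preblock and `y ∈ T(x)` satisfies `T(y) ⊆ T(x)`, then `T(y) = T(x)`. -/
theorem IsPreblock.nbhd_eq {U : Type*} {T : U → U → Prop} {x y : U}
    (h : IsPreblock T (nbhd T x)) (hxy : T x y) (hsub : nbhd T y ⊆ nbhd T x) :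
    nbhd T y = nbhd T x :=
  hsub.antisymm fun z hz => h.2 y hxy z hz

/-- `E`-equivalent elements have the same `T`-neighbourhood. -/
theorem Compatible.nbhd_eq {U : Type*} {E T : U → U → Prop} (h : Compatible E T)
    (hE : Equivalence E) {x y : U} (hxy : E x y) : nbhd T x = nbhd T y :=
  Set.ext fun z => ⟨fun hz => h y z ⟨x, hE.symm hxy, hz⟩, fun hz => h x z ⟨y, hxy, hz⟩⟩

/-- If infima in `RS(E,T)` are computed as in the ambient product lattice, then each block `T(x)`
with `x ∈ Σ_E \ Σ_T` is the neighbourhood of an element outside `Σ_E`. -/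
theorem exists_notMem_SigmaE_of_forall_iInter {U : Type*} {E T : U → U → Prop}
    (hE : Equivalence E) (hrefl : ∀ x, T x x) (hsymm : ∀ x y, T x y → T y x)
    (hH : ∀ H : Set (Set U), ∃ Y : Set U,
      lowerAppr E Y = ⋂ X ∈ H, lowerAppr E X ∧
      upperAppr T Y = upperAppr T (lowerAppr T (⋂ X ∈ H, upperAppr T X)))
    {x : U} (hx : x ∉ SigmaT T) (hblock : IsBlock T (nbhd T x)) :
    ∃ y, y ∉ SigmaE E ∧ nbhd T y = nbhd T x := by
  obtain ⟨Y, hYE, hYT⟩ := hH {{x}, {x}ᶜ}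
  simp only [Set.biInter_insert, Set.biInter_singleton] at hYE hYT
  obtain ⟨w, hxw, hwx⟩ : ∃ w, T x w ∧ w ≠ x := by
    by_contra! h
    exact hx (Set.ext fun y => ⟨h y, fun hy => hy ▸ hrefl x⟩)
  have hsing : upperAppr T {x} = nbhd T x := Set.ext fun u =>
    ⟨fun ⟨_, huv, hv⟩ => hsymm _ _ (hv ▸ huv), fun hu => ⟨x, hsymm _ _ hu, rfl⟩⟩
  have hcompl : upperAppr T {x}ᶜ = Set.univ := Set.eq_univ_of_forall fun u => by
    by_cases hu : u = x
    · exact ⟨w, hu ▸ hxw, hwx⟩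
    · exact ⟨u, hrefl u, hu⟩
  rw [hsing, hcompl, Set.inter_univ] at hYT
  have hsub : upperAppr T Y ⊆ nbhd T x := by
    rw [hYT]
    rintro u ⟨z, huz, hz⟩
    exact hz u (hsymm _ _ huz)
  obtain ⟨y, hxy, hy⟩ : x ∈ upperAppr T Y := hYT ▸ ⟨x, hrefl x, fun _ hy => hy⟩
  refine ⟨y, fun hyE => ?_, hblock.1.nbhd_eq hxy fun u hu => hsub ⟨y, hsymm _ _ hu, hy⟩⟩
  have hmem : y ∈ lowerAppr E Y := fun z hz =>
    (show z = y from (Set.ext_iff.1 hyE z).1 hz) ▸ hy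
  rw [hYE] at hmem
  exact hmem.2 y (hE.refl y) (hmem.1 y (hE.refl y))

/-- If each member of the covering inducing `T` is the neighbourhood of an element which lies
outside `Σ_E` or inside `Σ_T`, then infima in `RS(E,T)` are computed as in the ambient product
lattice. -/
theorem exists_lowerAppr_upperAppr_eq {U : Type*} {C : Set (Set U)} {E T : U → U → Prop}
    (hT : ∀ x y, T x y ↔ ∃ B ∈ C, x ∈ B ∧ y ∈ B)
    (hE : Equivalence E) (hrefl : ∀ x, T x x) (hsymm : ∀ x y, T x y → T y x)
    (hcomp : Compatible E T)
    (hp : ∀ B ∈ C, ∃ y, nbhd T y = B ∧ (y ∈ SigmaE E → y ∈ SigmaT T)) (H : Set (Set U)) :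
    ∃ Y : Set U, lowerAppr E Y = ⋂ X ∈ H, lowerAppr E X ∧
      upperAppr T Y = upperAppr T (lowerAppr T (⋂ X ∈ H, upperAppr T X)) := by
  choose p hpB hpS using hp
  set L := ⋂ X ∈ H, lowerAppr E X with hL
  set W := ⋂ X ∈ H, upperAppr T X with hW
  have hmemL : ∀ {x}, x ∈ L ↔ ∀ X ∈ H, x ∈ lowerAppr E X := by simp [hL]
  have hmemW : ∀ {x}, x ∈ W ↔ ∀ X ∈ H, x ∈ upperAppr T X := by simp [hW]
  have hLE : ∀ {x y}, x ∈ L → E x y → y ∈ L := fun hx hxy => hmemL.2 fun X hX z hyz =>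
    hmemL.1 hx X hX z (hE.trans hxy hyz)
  have hLW : L ⊆ lowerAppr T W := fun x hx y hxy => hmemW.2 fun X hX =>
    ⟨x, hsymm _ _ hxy, hmemL.1 hx X hX x (hE.refl x)⟩
  refine ⟨L ∪ {y | ∃ B, ∃ hB : B ∈ C, B ⊆ W ∧ y = p B hB}, Set.Subset.antisymm ?_ ?_,
    Set.Subset.antisymm ?_ ?_⟩
  · intro x hx
    rcases hx x (hE.refl x) with h | ⟨B, hB, hBW, hxp⟩
    · exact h
    by_cases hxE : x ∈ SigmaE E
    · have hxT : nbhd T x = {x} := by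
        have := hpS B hB (hxp ▸ hxE)
        rwa [← hxp] at this
      have hxW : x ∈ W := hBW (by rw [← hpB B hB, ← hxp]; exact hrefl x)
      refine hmemL.2 fun X hX y hxy => ?_
      obtain ⟨z, hxz, hz⟩ := hmemW.1 hxW X hX
      have hyx : y = x := (Set.ext_iff.1 hxE y).1 hxy
      have hzx : z = x := (Set.ext_iff.1 hxT z).1 hxz
      rwa [hyx, ← hzx]
    · obtain ⟨z, hxz, hzx⟩ : ∃ z, E x z ∧ z ≠ x := by
        by_contra! h
        exact hxE (Set.ext fun y => ⟨h y, fun hy => hy ▸ hE.refl x⟩)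
      rcases hx z hxz with h | ⟨D, hD, -, hzp⟩
      · exact hLE h (hE.symm hxz)
      · have hBD : B = D := by
          rw [← hpB B hB, ← hpB D hD, ← hxp, ← hzp, hcomp.nbhd_eq hE hxz]
        subst hBD
        exact absurd (hzp.trans hxp.symm) hzx
  · exact fun x hx y hxy => Or.inl (hLE hx hxy)
  · rintro x ⟨y, hxy, hy | ⟨B, hB, hBW, rfl⟩⟩
    · exact ⟨y, hxy, hLW hy⟩
    · exact ⟨_, hxy, fun z hz => hBW (hpB B hB ▸ hz)⟩
  · rintro x ⟨z, hxz, hz⟩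
    obtain ⟨B, hB, hxB, hzB⟩ := (hT x z).1 hxz
    refine ⟨p B hB, hsymm _ _ ?_, Or.inr ⟨B, hB, fun u hu => ?_, rfl⟩⟩
    · rw [← hpB B hB] at hxB
      exact hxB
    · exact hz u ((hT z u).2 ⟨B, hB, hzB, hu⟩)

/-- for a tolerance `T` induced by an irredundant covering and an
equivalence `E` with `T` `E`-compatible: `RS(E,T)` is a complete sublattice of
`℘(U)_E × ℘(U)^T` iff condition (CSub) holds: for each `x ∈ Σ_E \ Σ_T` such that
`T(x)` is a block, there exists `y ∉ Σ_E` with `T(y) = T(x)`. -/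
theorem RS_complete_sublattice_iff_CSub {U : Type*} (C : Set (Set U))
    (hne : ∀ B ∈ C, B.Nonempty) (hcov : ⋃₀ C = Set.univ)
    (hirr : ∀ B ∈ C, ⋃₀ (C \ {B}) ≠ Set.univ)
    (T : U → U → Prop) (hT : T = fun x y : U => ∃ B ∈ C, x ∈ B ∧ y ∈ B)
    (E : U → U → Prop) (hE : Equivalence E) (hcomp : Compatible E T) :
    (∀ H : Set (Set U), ∃ Y : Set U,
        lowerAppr E Y = ⋂ X ∈ H, lowerAppr E X ∧
        upperAppr T Y = upperAppr T (lowerAppr T (⋂ X ∈ H, upperAppr T X)))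
    ↔ (∀ x ∈ SigmaE E \ SigmaT T, IsBlock T (nbhd T x) →
        ∃ y, y ∉ SigmaE E ∧ nbhd T y = nbhd T x) := by
  have hT' : ∀ x y, T x y ↔ ∃ B ∈ C, x ∈ B ∧ y ∈ B := fun x y => by rw [hT]
  have hrefl : ∀ x, T x x := fun x => by
    obtain ⟨B, hB, hx⟩ : x ∈ ⋃₀ C := hcov ▸ Set.mem_univ x
    exact (hT' x x).2 ⟨B, hB, hx, hx⟩
  have hsymm : ∀ x y, T x y → T y x := fun x y h => by
    obtain ⟨B, hB, hx, hy⟩ := (hT' x y).1 h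
    exact (hT' y x).2 ⟨B, hB, hy, hx⟩
  refine ⟨fun hH x hx hblock =>
    exists_notMem_SigmaE_of_forall_iInter hE hrefl hsymm hH hx.2 hblock, fun hCSub =>
    exists_lowerAppr_upperAppr_eq hT' hE hrefl hsymm hcomp fun B hB => ?_⟩
  obtain ⟨b, hb⟩ : ∃ b, nbhd T b = B := hT ▸ exists_nbhd_eq_of_irredundant hcov hirr hB
  by_cases hbS : b ∈ SigmaE E \ SigmaT T
  · have hpre : IsPreblock T (nbhd T b) :=
      hb ▸ ⟨hne B hB, fun u hu v hv => (hT' u v).2 ⟨B, hB, hu, hv⟩⟩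
    obtain ⟨y, hyE, hy⟩ := hCSub b hbS (hpre.isBlock_nbhd (hrefl b))
    exact ⟨y, hy.trans hb, fun h => absurd h hyE⟩
  · exact ⟨b, hb, fun h => by_contra fun h' => hbS ⟨h, h'⟩⟩
end

section
/- Let T be the tolerance induced by an irredundant covering of U and let E be an equivalence on U such that T is E-compatible, and assume condition (CSub) holds. Let X ⊆ U, A = X_E, B = X^T, and set P₁ = ((Bᶜ)^T)_T and P₂ = (Bᶜ)^T. Then: (i) there exists Z ⊆ U with Z_E = P₁ and Z^T = P₂; (ii) A ∩ P₁ = ∅ and (B ∩ P₂)_T = ∅; and (iii) for every Y ⊆ U, if A ∩ Y_E = ∅ and (B ∩ Y^T)_T = ∅, then Y_E ⊆ P₁ and Y^T ⊆ P₂. In other words, (P₁, P₂) is the pseudocomplement of (A, B) in RS(E,T). -/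
/-- Every member of an irredundant covering has a point lying in no other member. -/
theorem exists_private_point {U : Type*} {C : Set (Set U)} (hcov : ⋃₀ C = Set.univ)
    {B : Set U} (h : ⋃₀ (C \ {B}) ≠ Set.univ) :
    ∃ p ∈ B, ∀ D ∈ C, p ∈ D → D = B := by
  obtain ⟨p, hp⟩ := (Set.ne_univ_iff_exists_notMem _).1 h
  have huniq : ∀ D ∈ C, p ∈ D → D = B := fun D hD hpD => by
    by_contra hDB
    exact hp ⟨D, ⟨hD, hDB⟩, hpD⟩
  obtain ⟨D, hD, hpD⟩ : p ∈ ⋃₀ C := hcov ▸ Set.mem_univ p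
  exact ⟨p, huniq D hD hpD ▸ hpD, huniq⟩

/-- In the tolerance induced by an irredundant covering, any two related elements lie in a
common neighbourhood which is a preblock. -/
theorem exists_nbhd_clique {U : Type*} {C : Set (Set U)} (hcov : ⋃₀ C = Set.univ)
    (hirr : ∀ B ∈ C, ⋃₀ (C \ {B}) ≠ Set.univ) {T : U → U → Prop}
    (hT : T = fun x y : U => ∃ B ∈ C, x ∈ B ∧ y ∈ B) {x y : U} (hxy : T x y) :
    ∃ p, T p x ∧ T p y ∧ ∀ u v, T p u → T p v → T u v := by
  subst hT
  obtain ⟨B, hB, hx, hy⟩ := hxy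
  obtain ⟨p, hp, huniq⟩ := exists_private_point hcov (hirr B hB)
  refine ⟨p, ⟨B, hB, hp, hx⟩, ⟨B, hB, hp, hy⟩, ?_⟩
  rintro u v ⟨D, hD, hpD, hu⟩ ⟨D', hD', hpD', hv⟩
  obtain rfl := huniq D hD hpD
  obtain rfl := huniq D' hD' hpD'
  exact ⟨_, hD, hu, hv⟩

/-- under (CSub), with `A = X_E`, `B = X^T`, the pair
`(((Bᶜ)^T)_T, (Bᶜ)^T)` is the pseudocomplement of `(A, B)` in `RS(E,T)`. -/
theorem RS_pseudocomplement {U : Type*} (C : Set (Set U))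
    (hne : ∀ B ∈ C, B.Nonempty) (hcov : ⋃₀ C = Set.univ)
    (hirr : ∀ B ∈ C, ⋃₀ (C \ {B}) ≠ Set.univ)
    (T : U → U → Prop) (hT : T = fun x y : U => ∃ B ∈ C, x ∈ B ∧ y ∈ B)
    (E : U → U → Prop) (hE : Equivalence E) (hcomp : Compatible E T)
    (hCSub : ∀ x ∈ SigmaE E \ SigmaT T, IsBlock T (nbhd T x) →
      ∃ y, y ∉ SigmaE E ∧ nbhd T y = nbhd T x)
    (X : Set U) :
    (∃ Z : Set U,
        lowerAppr E Z = lowerAppr T (upperAppr T (upperAppr T X)ᶜ) ∧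
        upperAppr T Z = upperAppr T (upperAppr T X)ᶜ) ∧
    (lowerAppr E X ∩ lowerAppr T (upperAppr T (upperAppr T X)ᶜ) = ∅ ∧
     lowerAppr T (upperAppr T X ∩ upperAppr T (upperAppr T X)ᶜ) = ∅) ∧
    (∀ Y : Set U,
      lowerAppr E X ∩ lowerAppr E Y = ∅ →
      lowerAppr T (upperAppr T X ∩ upperAppr T Y) = ∅ →
      lowerAppr E Y ⊆ lowerAppr T (upperAppr T (upperAppr T X)ᶜ) ∧
      upperAppr T Y ⊆ upperAppr T (upperAppr T X)ᶜ) := by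
  have hrefl : ∀ x, T x x := fun x => by
    obtain ⟨B, hB, hx⟩ : x ∈ ⋃₀ C := hcov ▸ Set.mem_univ x
    exact hT ▸ ⟨B, hB, hx, hx⟩
  have hsymm : ∀ {x y}, T x y → T y x := by
    subst hT
    rintro x y ⟨B, hB, hx, hy⟩
    exact ⟨B, hB, hy, hx⟩
  have hclique := fun {x y : U} (h : T x y) => exists_nbhd_clique hcov hirr hT h
  refine ⟨⟨lowerAppr T (upperAppr T (upperAppr T X)ᶜ), ?_, ?_⟩, ⟨?_, ?_⟩, fun Y _ hY => ?_⟩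
  · ext x
    exact ⟨fun h => h x (hE.refl x), fun h y hxy z hyz => h z (hcomp x z ⟨y, hxy, hyz⟩)⟩
  · ext x
    constructor
    · rintro ⟨y, hxy, hy⟩
      exact hy x (hsymm hxy)
    · rintro ⟨y, hxy, hy⟩
      exact ⟨y, hxy, fun z hyz => ⟨y, hsymm hyz, hy⟩⟩
  · refine Set.eq_empty_iff_forall_notMem.2 ?_
    rintro x ⟨hxX, hx⟩
    obtain ⟨y, hxy, hy⟩ := hx x (hrefl x)
    exact hy ⟨x, hsymm hxy, hxX x (hE.refl x)⟩
  · refine Set.eq_empty_iff_forall_notMem.2 fun x hx => ?_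
    obtain ⟨p, hpx, -, hp⟩ := hclique (hrefl x)
    obtain ⟨⟨z, hpz, hz⟩, y, hpy, hy⟩ := hx p (hsymm hpx)
    exact hy ⟨z, hp y z hpy hpz, hz⟩
  · have hsub : upperAppr T Y ⊆ upperAppr T (upperAppr T X)ᶜ := by
      rintro x ⟨y, hxy, hy⟩
      obtain ⟨p, hpx, hpy, hp⟩ := hclique hxy
      refine ⟨p, hsymm hpx, ?_⟩
      rintro ⟨z, hpz, hz⟩
      exact Set.eq_empty_iff_forall_notMem.1 hY p fun w hpw =>
        ⟨⟨z, hp w z hpw hpz, hz⟩, y, hp w y hpw hpy, hy⟩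
    exact ⟨fun x hx y hxy => hsub ⟨x, hsymm hxy, hx x (hE.refl x)⟩, hsub⟩
end

section
/- Let T be the tolerance induced by an irredundant covering of U and let E be an equivalence on U such that T is E-compatible, and assume condition (CSub) holds. Let X ⊆ U, A = X_E, B = X^T, and set Q₁ = Aᶜ and Q₂ = (Aᶜ)^T. Then: (i) there exists Z ⊆ U with Z_E = Q₁ and Z^T = Q₂; (ii) A ∪ Q₁ = U and B ∪ Q₂ = U; and (iii) for every Y ⊆ U, if A ∪ Y_E = U and B ∪ Y^T = U, then Q₁ ⊆ Y_E and Q₂ ⊆ Y^T. In other words, (Q₁, Q₂) is the dual pseudocomplement of (A, B) in RS(E,T). -/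
theorem lowerAppr_subset {U : Type*} {R : U → U → Prop} (hR : ∀ x, R x x) (X : Set U) :
    lowerAppr R X ⊆ X :=
  fun x hx => hx x (hR x)

theorem subset_upperAppr {U : Type*} {R : U → U → Prop} (hR : ∀ x, R x x) (X : Set U) :
    X ⊆ upperAppr R X :=
  fun x hx => ⟨x, hR x, hx⟩

theorem upperAppr_mono {U : Type*} (R : U → U → Prop) {X Y : Set U} (h : X ⊆ Y) :
    upperAppr R X ⊆ upperAppr R Y :=
  fun _ ⟨y, hxy, hy⟩ => ⟨y, hxy, h hy⟩

theorem lowerAppr_compl_lowerAppr {U : Type*} {E : U → U → Prop} (hE : Equivalence E)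
    (X : Set U) : lowerAppr E (lowerAppr E X)ᶜ = (lowerAppr E X)ᶜ :=
  (lowerAppr_subset hE.refl _).antisymm fun _ hx _ hxy hy =>
    hx fun z hxz => hy z (hE.trans (hE.symm hxy) hxz)

/-- under (CSub), with `A = X_E`, `B = X^T`, the pair
`(Aᶜ, (Aᶜ)^T)` is the dual pseudocomplement of `(A, B)` in `RS(E,T)`. -/
theorem RS_dual_pseudocomplement {U : Type*} (C : Set (Set U))
    (hne : ∀ B ∈ C, B.Nonempty) (hcov : ⋃₀ C = Set.univ)
    (hirr : ∀ B ∈ C, ⋃₀ (C \ {B}) ≠ Set.univ)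
    (T : U → U → Prop) (hT : T = fun x y : U => ∃ B ∈ C, x ∈ B ∧ y ∈ B)
    (E : U → U → Prop) (hE : Equivalence E) (hcomp : Compatible E T)
    (hCSub : ∀ x ∈ SigmaE E \ SigmaT T, IsBlock T (nbhd T x) →
      ∃ y, y ∉ SigmaE E ∧ nbhd T y = nbhd T x)
    (X : Set U) :
    (∃ Z : Set U,
        lowerAppr E Z = (lowerAppr E X)ᶜ ∧
        upperAppr T Z = upperAppr T (lowerAppr E X)ᶜ) ∧
    (lowerAppr E X ∪ (lowerAppr E X)ᶜ = Set.univ ∧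
     upperAppr T X ∪ upperAppr T (lowerAppr E X)ᶜ = Set.univ) ∧
    (∀ Y : Set U,
      lowerAppr E X ∪ lowerAppr E Y = Set.univ →
      upperAppr T X ∪ upperAppr T Y = Set.univ →
      (lowerAppr E X)ᶜ ⊆ lowerAppr E Y ∧
      upperAppr T (lowerAppr E X)ᶜ ⊆ upperAppr T Y) := by
  have hTrefl : ∀ x, T x x := by
    intro x
    obtain ⟨B, hB, hxB⟩ := Set.mem_sUnion.1 (hcov ▸ Set.mem_univ x)
    rw [hT]
    exact ⟨B, hB, hxB, hxB⟩
  refine ⟨⟨_, lowerAppr_compl_lowerAppr hE X, rfl⟩, ⟨Set.union_compl_self _, ?_⟩, ?_⟩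
  · rw [Set.eq_univ_iff_forall]
    intro x
    by_cases hx : x ∈ lowerAppr E X
    · exact Or.inl (subset_upperAppr hTrefl X (lowerAppr_subset hE.refl X hx))
    · exact Or.inr (subset_upperAppr hTrefl _ hx)
  · intro Y hY _
    have hsub : (lowerAppr E X)ᶜ ⊆ lowerAppr E Y := Set.compl_subset_iff_union.2 hY
    exact ⟨hsub, upperAppr_mono T (hsub.trans (lowerAppr_subset hE.refl Y))⟩
end

section
/- Let T be the tolerance induced by an irredundant covering of U and let E be an equivalence on U such that T is E-compatible, and assume condition (CSub) holds. Let X, Y ⊆ U and write A = X_E, B = X^T, C = Y_E, D = Y^T. If (((Bᶜ)^T)_T, (Bᶜ)^T) = (((Dᶜ)^T)_T, (Dᶜ)^T) and (Aᶜ, (Aᶜ)^T) = (Cᶜ, (Cᶜ)^T), then (A, B) = (C, D). That is, the double p-algebra RS(E,T) is regular: elements with equal pseudocomplements and equal dual pseudocomplements coincide. -/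
/-- For a symmetric relation, an upper approximation `B = X^R` is recovered from `(Bᶜ)^R`. -/
theorem upperAppr_eq_upperAppr_compl_upperAppr_compl {U : Type*} {R : U → U → Prop}
    (hR : ∀ x y, R x y → R y x) (X : Set U) :
    upperAppr R X = upperAppr R (upperAppr R (upperAppr R X)ᶜ)ᶜ := by
  ext x
  constructor
  · rintro ⟨z, hxz, hz⟩
    exact ⟨z, hxz, fun ⟨w, hzw, hw⟩ => hw ⟨z, hR z w hzw, hz⟩⟩
  · rintro ⟨z, hxz, hz⟩
    by_contra hx
    exact hz ⟨x, hR x z hxz, hx⟩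

/-- under (CSub), the double p-algebra `RS(E,T)` is regular:
if two rough sets have the same pseudocomplement and the same dual
pseudocomplement, then they coincide. -/
theorem RS_regular {U : Type*} (C : Set (Set U))
    (hne : ∀ B ∈ C, B.Nonempty) (hcov : ⋃₀ C = Set.univ)
    (hirr : ∀ B ∈ C, ⋃₀ (C \ {B}) ≠ Set.univ)
    (T : U → U → Prop) (hT : T = fun x y : U => ∃ B ∈ C, x ∈ B ∧ y ∈ B)
    (E : U → U → Prop) (hE : Equivalence E) (hcomp : Compatible E T)
    (hCSub : ∀ x ∈ SigmaE E \ SigmaT T, IsBlock T (nbhd T x) →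
      ∃ y, y ∉ SigmaE E ∧ nbhd T y = nbhd T x)
    (X Y : Set U) :
    (lowerAppr T (upperAppr T (upperAppr T X)ᶜ), upperAppr T (upperAppr T X)ᶜ) =
      (lowerAppr T (upperAppr T (upperAppr T Y)ᶜ), upperAppr T (upperAppr T Y)ᶜ) →
    ((lowerAppr E X)ᶜ, upperAppr T (lowerAppr E X)ᶜ) =
      ((lowerAppr E Y)ᶜ, upperAppr T (lowerAppr E Y)ᶜ) →
    (lowerAppr E X, upperAppr T X) = (lowerAppr E Y, upperAppr T Y) := by
  intro hpseudo hdual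
  have hsymm : ∀ x y, T x y → T y x := by
    subst hT
    rintro x y ⟨B, hB, hx, hy⟩
    exact ⟨B, hB, hy, hx⟩
  have hlower : lowerAppr E X = lowerAppr E Y := compl_injective (Prod.mk.inj hdual).1
  have hupper : upperAppr T X = upperAppr T Y := by
    rw [upperAppr_eq_upperAppr_compl_upperAppr_compl hsymm X, (Prod.mk.inj hpseudo).2,
      ← upperAppr_eq_upperAppr_compl_upperAppr_compl hsymm Y]
  rw [hlower, hupper]
end

section
/- Let E and F be equivalences on a set U with E ⊆ F. Then the following are equivalent: (a) for every family H of subsets of U there exists Y ⊆ U with Y_E = ⋂_{X∈H} X_E and Y^F = ((⋂_{X∈H} X^F)_F)^F (i.e., RS(E,F) is a complete sublattice of ℘(U)_E × ℘(U)^F); (b) condition (CSub°) holds: for every x ∈ U, if [x]_F is not a singleton, then there exists y ∈ U with y F x and [y]_E not a singleton. -/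
theorem upperAppr_lowerAppr_iInter_upperAppr {U : Type*} {F : U → U → Prop}
    (hF : Equivalence F) (H : Set (Set U)) :
    upperAppr F (lowerAppr F (⋂ X ∈ H, upperAppr F X)) = ⋂ X ∈ H, upperAppr F X := by
  ext x
  simp only [upperAppr, lowerAppr, Set.mem_iInter, Set.mem_ofPred_eq]
  constructor
  · rintro ⟨y, hxy, hy⟩
    exact hy x (hF.symm hxy)
  · refine fun h => ⟨x, hF.refl x, fun y hxy X hX => ?_⟩
    obtain ⟨z, hxz, hz⟩ := h X hX
    exact ⟨z, hF.trans (hF.symm hxy) hxz, hz⟩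

theorem exists_nontrivial_class_of_forall_exists_inf {U : Type*} {E F : U → U → Prop}
    (hE : Equivalence E) (hF : Equivalence F)
    (h : ∀ H : Set (Set U), ∃ Y : Set U,
        lowerAppr E Y = ⋂ X ∈ H, lowerAppr E X ∧
        upperAppr F Y = ⋂ X ∈ H, upperAppr F X)
    {x : U} (hx : {y | F x y} ≠ {x}) :
    ∃ y, F y x ∧ {z | E y z} ≠ {y} := by
  by_contra! hsingle
  obtain ⟨x', hxx', hne⟩ : ∃ x', F x x' ∧ x' ≠ x := by
    by_contra! hall
    exact hx (Set.ext fun y => ⟨hall y, fun hy => hy ▸ hF.refl x⟩)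
  obtain ⟨Y, hlow, hupp⟩ := h {{x}, {x'}}
  have hxY : x ∈ upperAppr F Y := by
    rw [hupp]
    simpa [upperAppr] using ⟨hF.refl x, hxx'⟩
  obtain ⟨y, hxy, hyY⟩ := hxY
  have hy : y ∈ lowerAppr E Y := fun z hyz =>
    (hsingle y (hF.symm hxy)).subset hyz ▸ hyY
  rw [hlow] at hy
  simp only [Set.mem_iInter] at hy
  have hyx : y = x := hy {x} (by simp) y (hE.refl y)
  have hyx' : y = x' := hy {x'} (by simp) y (hE.refl y)
  exact hne (hyx' ▸ hyx)

theorem exists_inf_of_nontrivial_class {U : Type*} {E F : U → U → Prop}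
    (hE : Equivalence E) (hF : Equivalence F) (hEF : ∀ x y, E x y → F x y)
    (h : ∀ x : U, {y | F x y} ≠ {x} → ∃ y, F y x ∧ {z | E y z} ≠ {y})
    (H : Set (Set U)) :
    ∃ Y : Set U,
        lowerAppr E Y = ⋂ X ∈ H, lowerAppr E X ∧
        upperAppr F Y = ⋂ X ∈ H, upperAppr F X := by
  obtain ⟨rep, hrep, hrep_eq⟩ :
      ∃ rep : U → U, (∀ x, E x (rep x)) ∧ ∀ x y, E x y → rep x = rep y := by
    let s : Setoid U := ⟨E, hE⟩
    exact ⟨fun x => (Quotient.mk s x).out,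
      fun x => hE.symm (Quotient.mk_out (s := s) x),
      fun x y hxy => congrArg Quotient.out (Quotient.sound (s := s) hxy)⟩
  set P := ⋂ X ∈ H, lowerAppr E X with hP
  set Q := ⋂ X ∈ H, upperAppr F X with hQ
  have P_closed : ∀ x y, E x y → x ∈ P → y ∈ P := by
    intro x y hxy hx
    simp only [hP, Set.mem_iInter] at hx ⊢
    exact fun X hX z hyz => hx X hX z (hE.trans hxy hyz)
  have Q_closed : ∀ x y, F x y → x ∈ Q → y ∈ Q := by
    intro x y hxy hx
    simp only [hQ, Set.mem_iInter] at hx ⊢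
    intro X hX
    obtain ⟨z, hxz, hz⟩ := hx X hX
    exact ⟨z, hF.trans (hF.symm hxy) hxz, hz⟩
  have P_sub_Q : P ⊆ Q := by
    intro x hx
    simp only [hP, hQ, Set.mem_iInter] at hx ⊢
    exact fun X hX => ⟨x, hF.refl x, hx X hX x (hE.refl x)⟩
  -- Adding one representative of each nontrivial `E`-class leaves the lower approximation alone.
  refine ⟨P ∪ {y | y ∈ Q ∧ {z | E y z} ≠ {y} ∧ rep y = y}, ?_, ?_⟩
  · ext x
    refine ⟨fun hx => ?_, fun hx y hxy => Or.inl (P_closed x y hxy hx)⟩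
    by_contra hxP
    have hmem : ∀ y, E x y → {z | E y z} ≠ {y} ∧ rep y = y := fun y hxy =>
      ((hx y hxy).resolve_left fun hy => hxP (P_closed y x (hE.symm hxy) hy)).2
    obtain ⟨hne, hxrep⟩ := hmem x (hE.refl x)
    refine hne (Set.ext fun z => ⟨fun hxz => ?_, fun hz => hz ▸ hE.refl x⟩)
    exact (hmem z hxz).2.symm.trans ((hrep_eq x z hxz).symm.trans hxrep)
  · ext x
    constructor
    · rintro ⟨y, hxy, hy⟩
      exact Q_closed y x (hF.symm hxy) (hy.elim (fun hy => P_sub_Q hy) And.left)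
    · intro hx
      by_cases hsingle : {y | F x y} = {x}
      · refine ⟨x, hF.refl x, Or.inl ?_⟩
        simp only [hP, hQ, Set.mem_iInter] at hx ⊢
        intro X hX z hxz
        obtain ⟨w, hxw, hw⟩ := hx X hX
        have hzx : z = x := hsingle.subset (hEF x z hxz)
        have hwx : w = x := hsingle.subset hxw
        exact hzx.trans hwx.symm ▸ hw
      · obtain ⟨y, hyx, hne⟩ := h x hsingle
        have hxr : F x (rep y) := hF.trans (hF.symm hyx) (hEF _ _ (hrep y))
        refine ⟨rep y, hxr, Or.inr ⟨Q_closed _ _ hxr hx, fun hr => hne ?_,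
          (hrep_eq _ _ (hrep y)).symm⟩⟩
        have hyr : y = rep y := hr.subset (hE.symm (hrep y))
        rwa [← hyr] at hr

/-- for equivalences `E ⊆ F` on `U`, `RS(E,F)` is a complete
sublattice of `℘(U)_E × ℘(U)^F` iff condition (CSub°) holds: whenever `[x]_F` is
not a singleton, there exists `y F x` with `[y]_E` not a singleton. -/
theorem RS_equiv_complete_sublattice_iff {U : Type*} (E F : U → U → Prop)
    (hE : Equivalence E) (hF : Equivalence F)
    (hEF : ∀ x y, E x y → F x y) :
    (∀ H : Set (Set U), ∃ Y : Set U,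
        lowerAppr E Y = ⋂ X ∈ H, lowerAppr E X ∧
        upperAppr F Y = upperAppr F (lowerAppr F (⋂ X ∈ H, upperAppr F X)))
    ↔ (∀ x : U, {y | F x y} ≠ {x} → ∃ y, F y x ∧ {z | E y z} ≠ {y}) := by
  simp only [upperAppr_lowerAppr_iInter_upperAppr hF]
  exact ⟨fun h _ hx => exists_nontrivial_class_of_forall_exists_inf hE hF h hx,
    exists_inf_of_nontrivial_class hE hF hEF⟩
end
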